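/- arXiv:1903.04231 — 6 statements merged into one kernel-verified Lean document; each statement's English description precedes it below -/
import Mathlib

section
/- Let A be a real symmetric n×n matrix (2 ≤ m ≤ n−1) with eigenvalues μ_1, …, μ_n listed with multiplicity, and let W be the W-matrix of A. Then W is symmetric, and the multiset of eigenvalues of W (with multiplicity) equals the multiset of all sums μ_{i_1} + ⋯ + μ_{i_m} over m-element subsets {i_1 < ⋯ < i_m} of {1, …, n}. In particular, if A is diagonal then W is diagonal with diagonal entries w_{ᾱᾱ} = Σ_{i=1}^m a_{α_i α_i}. -/
open Finset

noncomputable section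

/-- The `k`-th elementary symmetric function of a finite family of reals. -/
def S {ι : Type*} [Fintype ι] (k : ℕ) (lam : ι → ℝ) : ℝ :=
  ∑ s ∈ Finset.univ.powersetCard k, ∏ i ∈ s, lam i

/-- The Gårding cone `Γ_k` in `ℝ^ι`. -/
def Gamma (ι : Type*) [Fintype ι] (k : ℕ) : Set (ι → ℝ) :=
  {lam | ∀ i : ℕ, 1 ≤ i → i ≤ k → 0 < S i lam}

/-- Increasing multi-indices of length `m` from `{1,…,n}`, i.e. `m`-element subsets of `Fin n`. -/
abbrev MIdx (n m : ℕ) := {s : Finset (Fin n) // s.card = m}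

/-- The vector of all `m`-fold sums of the entries of `μ`. -/
def sumVec (n m : ℕ) (μ : Fin n → ℝ) : MIdx n m → ℝ := fun s => ∑ i ∈ s.1, μ i

/-- The generalized Gårding cone `Γ_k^{(m)}`. -/
def GammaGen (n m k : ℕ) : Set (Fin n → ℝ) :=
  {μ | sumVec n m μ ∈ Gamma (MIdx n m) k}

/-- The `W`-matrix of a symmetric `n × n` matrix `A`. -/
def Wmat {n : ℕ} (m : ℕ) (A : Matrix (Fin n) (Fin n) ℝ) :
    Matrix (MIdx n m) (MIdx n m) ℝ := fun α β =>
  if α = β then ∑ i ∈ α.1, A i i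
  else if (α.1 \ β.1).card = 1 then
    ∑ i ∈ α.1 \ β.1, ∑ j ∈ β.1 \ α.1,
      (-1 : ℝ) ^ (Nat.dist ((α.1.filter (fun a => a < i)).card)
                           ((β.1.filter (fun b => b < j)).card)) * A i j
  else 0

/-- `S_k` of a matrix, as the sum of its `k × k` principal minors
(equal to `S_k` of the eigenvalues for symmetric matrices). -/
def Smat {ι : Type*} [Fintype ι] [DecidableEq ι] (k : ℕ) (M : Matrix ι ι ℝ) : ℝ :=
  ∑ s ∈ Finset.univ.powersetCard k,
    (M.submatrix (Subtype.val : {x // x ∈ s} → ι) (Subtype.val : {x // x ∈ s} → ι)).det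

abbrev E (n : ℕ) := EuclideanSpace ℝ (Fin n)

/-- The Hessian matrix of `u` at `x`. -/
def hess (n : ℕ) (u : E n → ℝ) (x : E n) : Matrix (Fin n) (Fin n) ℝ :=
  fun i j => iteratedFDeriv ℝ 2 u x ![EuclideanSpace.single i 1, EuclideanSpace.single j 1]


section ExteriorDerivation

variable {R M : Type*} [CommRing R] [AddCommGroup M] [Module R M]

/-- The multilinear map `v ↦ ∑ i, v₀ ∧ ⋯ ∧ T vᵢ ∧ ⋯`. -/
def derivationMultilinear (k : ℕ) (T : M →ₗ[R] M) :
    MultilinearMap R (fun _ : Fin k => M) (⋀[R]^k M) :=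
  ∑ i, (exteriorPower.ιMulti R k).toMultilinearMap.compLinearMap
    (fun j => if j = i then T else LinearMap.id)

lemma derivationMultilinear_apply (k : ℕ) (T : M →ₗ[R] M) (v : Fin k → M) :
    derivationMultilinear k T v =
      ∑ i, exteriorPower.ιMulti R k (Function.update v i (T (v i))) := by
  rw [derivationMultilinear, _root_.sum_apply]
  refine Finset.sum_congr rfl fun i _ => ?_
  rw [MultilinearMap.compLinearMap_apply, AlternatingMap.coe_multilinearMap]
  congr 1
  ext1 j
  by_cases h : j = i
  · subst h; simp
  · simp [h]

/-- `derivationMultilinear` as an alternating map. -/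
def derivationAlternating (k : ℕ) (T : M →ₗ[R] M) : M [⋀^Fin k]→ₗ[R] ⋀[R]^k M where
  toMultilinearMap := derivationMultilinear k T
  map_eq_zero_of_eq' := by
    intro v a b hab hne
    rw [MultilinearMap.toFun_eq_coe, derivationMultilinear_apply, Finset.sum_eq_add a b hne]
    · have : Function.update v b (T (v b)) = Function.update v a (T (v a)) ∘ Equiv.swap a b := by
        ext1 j
        by_cases hja : j = a
        · subst hja; simp [hne, hne.symm, hab]
        · by_cases hjb : j = b
          · subst hjb; simp [hab]
          · simp [Equiv.swap_apply_of_ne_of_ne hja hjb, hja, hjb]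
      rw [this, AlternatingMap.map_swap _ _ hne, add_neg_cancel]
    · rintro c - ⟨hca, hcb⟩
      exact AlternatingMap.map_eq_zero_of_eq _ _ (by simp [hca.symm, hcb.symm, hab]) hne
    · simp
    · simp

/-- The derivation of degree `0` of the exterior algebra extending `T`, restricted to the
`k`-th exterior power. -/
def exteriorDerivation (k : ℕ) (T : M →ₗ[R] M) : ⋀[R]^k M →ₗ[R] ⋀[R]^k M :=
  exteriorPower.alternatingMapLinearEquiv (derivationAlternating k T)

lemma exteriorDerivation_ιMulti (k : ℕ) (T : M →ₗ[R] M) (v : Fin k → M) :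
    exteriorDerivation k T (exteriorPower.ιMulti R k v) =
      ∑ i, exteriorPower.ιMulti R k (Function.update v i (T (v i))) := by
  rw [exteriorDerivation, exteriorPower.alternatingMapLinearEquiv_apply_ιMulti]
  exact derivationMultilinear_apply k T v

variable {n : ℕ}

/-- The basis of the `m`-th exterior power induced by a basis `b`, indexed by `MIdx n m`. -/
def wedgeBasis (m : ℕ) (b : Module.Basis (Fin n) R M) : Module.Basis (MIdx n m) R (⋀[R]^m M) :=
  b.exteriorPower m

lemma wedgeBasis_apply (m : ℕ) (b : Module.Basis (Fin n) R M) (s : MIdx n m) :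
    wedgeBasis m b s = exteriorPower.ιMulti R m (fun p => b (s.1.orderEmbOfFin s.2 p)) :=
  exteriorPower.basis_apply R m b s

lemma sum_orderEmbOfFin {N : Type*} [AddCommMonoid N] {m : ℕ} (s : Finset (Fin n))
    (h : s.card = m) (f : Fin n → N) : ∑ p, f (s.orderEmbOfFin h p) = ∑ i ∈ s, f i := by
  rw [← Finset.sum_coe_sort s]
  exact Fintype.sum_equiv (s.orderIsoOfFin h).toEquiv _ _ fun p => rfl

lemma card_filter_lt_orderEmbOfFin {m : ℕ} (s : Finset (Fin n)) (h : s.card = m) (p : Fin m) :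
    (s.filter (fun a => a < s.orderEmbOfFin h p)).card = p := by
  have : s.filter (fun a => a < s.orderEmbOfFin h p) =
      (Finset.Iio p).map (s.orderEmbOfFin h).toEmbedding := by
    ext a
    simp only [Finset.mem_filter, Finset.mem_map, Finset.mem_Iio, RelEmbedding.coe_toEmbedding]
    constructor
    · rintro ⟨ha, hlt⟩
      obtain ⟨q, rfl⟩ : a ∈ Set.range (s.orderEmbOfFin h) := by simpa using ha
      exact ⟨q, by simpa using hlt, rfl⟩
    · rintro ⟨q, hq, rfl⟩
      exact ⟨s.orderEmbOfFin_mem h q, by simpa using hq⟩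
  rw [this, Finset.card_map, Fin.card_Iio]

lemma orderEmbOfFin_succAbove {k : ℕ} (s : Finset (Fin n)) (h : s.card = k + 1) (p : Fin (k + 1))
    (h' : (s.erase (s.orderEmbOfFin h p)).card = k) (q : Fin k) :
    s.orderEmbOfFin h (p.succAbove q) = (s.erase (s.orderEmbOfFin h p)).orderEmbOfFin h' q := by
  refine congrFun (Finset.orderEmbOfFin_unique h' (f := fun q => s.orderEmbOfFin h (p.succAbove q))
    (fun q => ?_) ?_) q
  · simp [Fin.succAbove_ne]
  · exact (s.orderEmbOfFin h).strictMono.comp (Fin.strictMono_succAbove p)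

lemma ιMulti_update_orderEmbOfFin {k : ℕ} (v : Fin n → M) (s : Finset (Fin n))
    (h : s.card = k + 1) (p : Fin (k + 1)) (h' : (s.erase (s.orderEmbOfFin h p)).card = k) (x : M) :
    exteriorPower.ιMulti R (k + 1) (Function.update (fun q => v (s.orderEmbOfFin h q)) p x) =
      (-1 : R) ^ (s.filter (fun a => a < s.orderEmbOfFin h p)).card •
        exteriorPower.ιMulti R (k + 1)
        (Matrix.vecCons x
          fun q => v ((s.erase (s.orderEmbOfFin h p)).orderEmbOfFin h' q)) := by
  rw [card_filter_lt_orderEmbOfFin]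
  have : Function.update (fun q => v (s.orderEmbOfFin h q)) p x = p.insertNth x
      (fun q => v ((s.erase (s.orderEmbOfFin h p)).orderEmbOfFin h' q)) := by
    rw [Fin.eq_insertNth_iff]
    refine ⟨by simp, ?_⟩
    ext1 q
    simp [Fin.removeNth, Fin.succAbove_ne, orderEmbOfFin_succAbove s h p h']
  rw [this, AlternatingMap.map_insertNth]
  rw [← Int.cast_smul_eq_zsmul R]
  push_cast
  rfl

lemma ιMulti_vecCons_basis {k : ℕ} (b : Module.Basis (Fin n) R M) (r : Finset (Fin n))
    (h : r.card = k) (i : Fin n) (hi : i ∉ r) (h' : (insert i r).card = k + 1) :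
    exteriorPower.ιMulti R (k + 1) (Matrix.vecCons (b i) fun q => b (r.orderEmbOfFin h q)) =
      (-1 : R) ^ ((insert i r).filter (fun a => a < i)).card •
        wedgeBasis (k + 1) b ⟨insert i r, h'⟩ := by
  obtain ⟨p, hp⟩ : i ∈ Set.range ((insert i r).orderEmbOfFin h') := by simp
  have hu := ιMulti_update_orderEmbOfFin (R := R) b (insert i r) h' p
    (by rw [hp, Finset.erase_insert hi, h]) (b i)
  rw [Function.update_eq_self_iff.2 (by rw [hp])] at hu
  simp only [hp, Finset.erase_insert hi] at hu
  rw [wedgeBasis_apply, hu, smul_smul, ← mul_pow]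
  simp

lemma exteriorDerivation_wedgeBasis_of_eigenvectors (m : ℕ) (b : Module.Basis (Fin n) R M)
    (T : M →ₗ[R] M) (μ : Fin n → R) (hT : ∀ i, T (b i) = μ i • b i) (s : MIdx n m) :
    exteriorDerivation m T (wedgeBasis m b s) = (∑ i ∈ s.1, μ i) • wedgeBasis m b s := by
  rw [wedgeBasis_apply, exteriorDerivation_ιMulti, ← sum_orderEmbOfFin s.1 s.2, Finset.sum_smul]
  refine Finset.sum_congr rfl fun p _ => ?_
  rw [hT, AlternatingMap.map_update_smul, Function.update_eq_self]

/-- The coordinates of the wedge of the `b l`, `l ∈ β`, with the factor `b j` replaced by `b i`. -/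
lemma wedgeBasis_repr_update {k : ℕ} (b : Module.Basis (Fin n) R M) (α β : MIdx n (k + 1))
    (p : Fin (k + 1)) (j i : Fin n) (hj : β.1.orderEmbOfFin β.2 p = j) :
    (wedgeBasis (k + 1) b).repr (exteriorPower.ιMulti R (k + 1)
        (Function.update (fun q => b (β.1.orderEmbOfFin β.2 q)) p (b i))) α =
      if i ∉ β.1.erase j ∧ α.1 = insert i (β.1.erase j) then
        (-1 : R) ^ ((β.1.filter (fun a => a < j)).card + (α.1.filter (fun a => a < i)).card)
      else 0 := by
  subst hj
  have hcard : (β.1.erase (β.1.orderEmbOfFin β.2 p)).card = k := by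
    rw [Finset.card_erase_of_mem (β.1.orderEmbOfFin_mem β.2 p), β.2, Nat.add_sub_cancel]
  rw [ιMulti_update_orderEmbOfFin b β.1 β.2 p hcard]
  by_cases hi : i ∈ β.1.erase (β.1.orderEmbOfFin β.2 p)
  · obtain ⟨q, hq⟩ : i ∈ Set.range ((β.1.erase (β.1.orderEmbOfFin β.2 p)).orderEmbOfFin hcard) := by
      rwa [Finset.range_orderEmbOfFin]
    rw [AlternatingMap.map_eq_zero_of_eq _ _ (i := 0) (j := q.succ) (by simp [hq])
      (Fin.succ_ne_zero q).symm]
    simp [hi]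
  · have hc : (insert i (β.1.erase (β.1.orderEmbOfFin β.2 p))).card = k + 1 := by
      rw [Finset.card_insert_of_notMem hi, hcard]
    rw [ιMulti_vecCons_basis b _ hcard i hi hc, smul_smul, ← pow_add, map_smul,
      Module.Basis.repr_self, Finsupp.smul_apply, Finsupp.single_apply]
    by_cases hα : α.1 = insert i (β.1.erase (β.1.orderEmbOfFin β.2 p))
    · rw [if_pos (Subtype.ext hα.symm), if_pos ⟨hi, hα⟩, hα, smul_eq_mul, mul_one]
    · rw [if_neg (fun h => hα (congrArg Subtype.val h).symm), if_neg (fun h => hα h.2), smul_zero]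

/-- The coefficient of `exteriorDerivation` in a basis, as a sum over replacements of one index. -/
lemma wedgeBasis_repr_exteriorDerivation {k : ℕ} (b : Module.Basis (Fin n) R M) (T : M →ₗ[R] M)
    (α β : MIdx n (k + 1)) :
    (wedgeBasis (k + 1) b).repr (exteriorDerivation (k + 1) T (wedgeBasis (k + 1) b β)) α =
      ∑ j ∈ β.1, ∑ i, b.repr (T (b j)) i *
        if i ∉ β.1.erase j ∧ α.1 = insert i (β.1.erase j) then
          (-1 : R) ^ ((β.1.filter (fun a => a < j)).card + (α.1.filter (fun a => a < i)).card)
        else 0 := by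
  rw [wedgeBasis_apply, exteriorDerivation_ιMulti, ← sum_orderEmbOfFin β.1 β.2, map_sum,
    Finsupp.finsetSum_apply]
  refine Finset.sum_congr rfl fun p _ => ?_
  conv_lhs => rw [← b.sum_repr (T _)]
  rw [AlternatingMap.map_update_sum, map_sum, Finsupp.finsetSum_apply]
  refine Finset.sum_congr rfl fun i _ => ?_
  rw [AlternatingMap.map_update_smul, map_smul, Finsupp.smul_apply, smul_eq_mul,
    wedgeBasis_repr_update b α β p _ i rfl]

end ExteriorDerivation

lemma neg_one_pow_dist {R : Type*} [Ring R] (a b : ℕ) : (-1 : R) ^ Nat.dist a b = (-1) ^ (b + a) := by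
  rcases le_total a b with h | h
  · obtain ⟨c, rfl⟩ := Nat.exists_eq_add_of_le h
    rw [Nat.dist_eq_sub_of_le h, Nat.add_sub_cancel_left, show a + c + a = c + 2 * a by ring,
      pow_add, pow_mul]
    simp
  · obtain ⟨c, rfl⟩ := Nat.exists_eq_add_of_le h
    rw [Nat.dist_eq_sub_of_le_right h, Nat.add_sub_cancel_left, show b + (b + c) = c + 2 * b by ring,
      pow_add, pow_mul]
    simp

lemma eq_insert_erase_iff {n m : ℕ} (α β : MIdx n m) (hne : α ≠ β) {i j : Fin n} (hj : j ∈ β.1) :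
    (i ∉ β.1.erase j ∧ α.1 = insert i (β.1.erase j)) ↔ α.1 \ β.1 = {i} ∧ β.1 \ α.1 = {j} := by
  have hne' : α.1 ≠ β.1 := fun h => hne (Subtype.ext h)
  constructor
  · rintro ⟨hi, h⟩
    have hij : i ≠ j := by
      rintro rfl
      exact hne' (by rw [h, Finset.insert_erase hj])
    constructor <;> grind
  · rintro ⟨h1, h2⟩
    have hi : i ∈ α.1 \ β.1 := by simp [h1]
    have hj : j ∈ β.1 \ α.1 := by simp [h2]
    refine ⟨by grind, ?_⟩
    ext x
    have h1x := Finset.ext_iff.1 h1 x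
    have h2x := Finset.ext_iff.1 h2 x
    grind

/-- `Wmat` is the matrix of the derivation of the exterior power induced by `A`. -/
lemma toMatrix_exteriorDerivation {n k : ℕ} (A : Matrix (Fin n) (Fin n) ℝ) :
    LinearMap.toMatrix (wedgeBasis (k + 1) (Pi.basisFun ℝ (Fin n)))
      (wedgeBasis (k + 1) (Pi.basisFun ℝ (Fin n))) (exteriorDerivation (k + 1) A.mulVecLin) =
      Wmat (k + 1) A := by
  ext α β
  rw [LinearMap.toMatrix_apply, wedgeBasis_repr_exteriorDerivation]
  have hA : ∀ i j, (Pi.basisFun ℝ (Fin n)).repr (A.mulVecLin (Pi.basisFun ℝ (Fin n) j)) i =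
      A i j := by
    intro i j
    simp
  simp only [hA, mul_ite, mul_zero]
  unfold Wmat
  by_cases hαβ : α = β
  · subst hαβ
    rw [if_pos rfl]
    refine Finset.sum_congr rfl fun j hj => ?_
    rw [Finset.sum_eq_single j]
    · rw [if_pos ⟨by simp, (Finset.insert_erase hj).symm⟩, ← two_mul, pow_mul]
      simp
    · intro i _ hij
      refine if_neg ?_
      rintro ⟨hi, h⟩
      exact hi (Finset.mem_erase.2 ⟨hij, h ▸ Finset.mem_insert_self _ _⟩)
    · simp
  · rw [if_neg hαβ]
    have hcard : (α.1 \ β.1).card = (β.1 \ α.1).card :=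
      Finset.card_sdiff_comm (α.2.trans β.2.symm)
    split_ifs with h1
    · obtain ⟨i₀, hi₀⟩ := Finset.card_eq_one.1 h1
      obtain ⟨j₀, hj₀⟩ := Finset.card_eq_one.1 (hcard ▸ h1)
      have hj₀' : j₀ ∈ β.1 := (Finset.mem_sdiff.1 (hj₀ ▸ Finset.mem_singleton_self j₀)).1
      rw [hi₀, hj₀, Finset.sum_singleton, Finset.sum_singleton, Finset.sum_eq_single_of_mem j₀ hj₀',
        Finset.sum_eq_single i₀]
      · rw [if_pos ((eq_insert_erase_iff α β hαβ hj₀').2 ⟨hi₀, hj₀⟩), neg_one_pow_dist, mul_comm]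
      · intro i _ hi
        refine if_neg fun h => hi ?_
        have := ((eq_insert_erase_iff α β hαβ hj₀').1 h).1
        exact (Finset.singleton_injective (hi₀.symm.trans this)).symm
      · simp
      · intro j hj hjne
        refine Finset.sum_eq_zero fun i _ => if_neg fun h => hjne ?_
        have := ((eq_insert_erase_iff α β hαβ hj).1 h).2
        exact (Finset.singleton_injective (hj₀.symm.trans this)).symm
    · refine Finset.sum_eq_zero fun j hj => Finset.sum_eq_zero fun i _ => if_neg fun h => h1 ?_
      rw [((eq_insert_erase_iff α β hαβ hj).1 h).1, Finset.card_singleton]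

lemma Wmat_isSymm {n m : ℕ} {A : Matrix (Fin n) (Fin n) ℝ} (hA : A.IsSymm) :
    (Wmat m A).IsSymm := by
  ext α β
  rw [Matrix.transpose_apply]
  unfold Wmat
  by_cases h : α = β
  · subst h; rfl
  · rw [if_neg h, if_neg (Ne.symm h), Finset.card_sdiff_comm (α.2.trans β.2.symm),
      Finset.sum_comm]
    simp only [hA.apply, Nat.dist_comm]

lemma Wmat_isDiag {n m : ℕ} {A : Matrix (Fin n) (Fin n) ℝ} (hA : A.IsDiag) :
    (Wmat m A).IsDiag := by
  intro α β h
  unfold Wmat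
  rw [if_neg h, ite_eq_right_iff]
  refine fun _ => Finset.sum_eq_zero fun i hi => Finset.sum_eq_zero fun j hj => ?_
  rw [hA, mul_zero]
  rintro rfl
  exact (Finset.mem_sdiff.1 hi).2 (Finset.mem_sdiff.1 hj).1

lemma charpoly_Wmat {n k : ℕ} {A : Matrix (Fin n) (Fin n) ℝ} (hA : A.IsHermitian) :
    (Wmat (k + 1) A).charpoly = ∏ s : MIdx n (k + 1),
      (Polynomial.X - Polynomial.C (∑ i ∈ s.1, hA.eigenvalues i)) := by
  let f : Module.Basis (Fin n) ℝ (Fin n → ℝ) :=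
    hA.eigenvectorBasis.toBasis.map (WithLp.linearEquiv 2 ℝ (Fin n → ℝ))
  have hf : ∀ i, A.mulVecLin (f i) = hA.eigenvalues i • f i := by
    intro i
    simpa [f] using hA.mulVec_eigenvectorBasis i
  have hdiag : LinearMap.toMatrix (wedgeBasis (k + 1) f) (wedgeBasis (k + 1) f)
      (exteriorDerivation (k + 1) A.mulVecLin) =
      Matrix.diagonal fun s : MIdx n (k + 1) => ∑ i ∈ s.1, hA.eigenvalues i := by
    ext s t
    rw [LinearMap.toMatrix_apply, exteriorDerivation_wedgeBasis_of_eigenvectors _ f _ _ hf,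
      map_smul, Module.Basis.repr_self, Finsupp.smul_apply, Finsupp.single_apply,
      Matrix.diagonal_apply]
    by_cases h : s = t
    · subst h; simp
    · simp [h, Ne.symm h]
  rw [← toMatrix_exteriorDerivation,
    LinearMap.charpoly_toMatrix _ (wedgeBasis (k + 1) (Pi.basisFun ℝ (Fin n))),
    ← LinearMap.charpoly_toMatrix _ (wedgeBasis (k + 1) f), hdiag, Matrix.charpoly_diagonal]

/-- The `W`-matrix of a real symmetric matrix is symmetric, its multiset of
eigenvalues (with multiplicity) is the multiset of all `m`-fold sums of eigenvalues of `A`,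
and if `A` is diagonal then `W` is diagonal with diagonal entries `∑_{i ∈ ᾱ} a_{ii}`. -/
theorem stmt0 (n m : ℕ) (hm2 : 2 ≤ m) (hm : m ≤ n - 1)
    (A : Matrix (Fin n) (Fin n) ℝ) (hA : A.IsHermitian) :
    (Wmat m A).IsSymm ∧
    (∃ hW : (Wmat m A).IsHermitian,
      Finset.univ.val.map hW.eigenvalues =
        Finset.univ.val.map (fun s : MIdx n m => ∑ i ∈ s.1, hA.eigenvalues i)) ∧
    (A.IsDiag → (Wmat m A).IsDiag ∧ ∀ α : MIdx n m, Wmat m A α α = ∑ i ∈ α.1, A i i) := by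
  obtain ⟨k, rfl⟩ : ∃ k, m = k + 1 := ⟨m - 1, by omega⟩
  have hsymm : A.IsSymm := by simpa [Matrix.IsHermitian, Matrix.IsSymm] using hA
  have hW : (Wmat (k + 1) A).IsHermitian := by
    simpa [Matrix.IsHermitian, Matrix.IsSymm] using Wmat_isSymm (m := k + 1) hsymm
  refine ⟨Wmat_isSymm hsymm, ⟨hW, ?_⟩, fun hd => ⟨Wmat_isDiag hd, fun α => by simp [Wmat]⟩⟩
  have hroots := hW.roots_charpoly_eq_eigenvalues
  rw [charpoly_Wmat hA, Polynomial.roots_prod _ _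
    (Finset.prod_ne_zero_iff.2 fun _ _ => Polynomial.X_sub_C_ne_zero _)] at hroots
  simp only [Polynomial.roots_X_sub_C, Multiset.bind_singleton] at hroots
  exact hroots.symm
end
end

section
/- For any n ≥ 2, any 1 ≤ m ≤ n−1 and any 1 ≤ k ≤ C_n^m, the generalized Gårding cones satisfy the inclusions Γ_n ⊆ Γ_k^{(m)} ⊆ Γ_1, where Γ_n and Γ_1 are the usual Gårding cones in ℝ^n. -/
open Finset

noncomputable section

theorem prod_const_add_eq_sum_S {ι : Type*} [Fintype ι] (t : ℝ) (lam : ι → ℝ) :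
    ∏ i, (lam i + t) =
      ∑ j ∈ range (Fintype.card ι + 1), S j lam * t ^ (Fintype.card ι - j) := by
  classical
  rw [Finset.prod_add, Finset.sum_powerset]
  refine Finset.sum_congr rfl fun j _ => ?_
  rw [S, Finset.sum_mul]
  refine Finset.sum_congr rfl fun s hs => ?_
  rw [Finset.prod_const, Finset.card_sdiff_of_subset (Finset.subset_univ s), Finset.card_univ,
    (Finset.mem_powersetCard.mp hs).2]

/-- The top Gårding cone is contained in the positive orthant. -/
theorem pos_of_mem_Gamma_card {ι : Type*} [Fintype ι] {lam : ι → ℝ}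
    (h : lam ∈ Gamma ι (Fintype.card ι)) (i : ι) : 0 < lam i := by
  by_contra! hi
  have ht : 0 ≤ -lam i := neg_nonneg.mpr hi
  have hcard : 1 ≤ Fintype.card ι := Fintype.card_pos_iff.mpr ⟨i⟩
  have hzero : ∏ j, (lam j + -lam i) = 0 :=
    Finset.prod_eq_zero (Finset.mem_univ i) (add_neg_cancel _)
  rw [prod_const_add_eq_sum_S, Finset.sum_range_succ, Nat.sub_self, pow_zero, mul_one] at hzero
  have htop : 0 < S (Fintype.card ι) lam := h _ hcard le_rfl
  have hnonneg : 0 ≤ ∑ j ∈ range (Fintype.card ι),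
      S j lam * (-lam i) ^ (Fintype.card ι - j) := by
    refine Finset.sum_nonneg fun j hj => mul_nonneg ?_ (pow_nonneg ht _)
    rcases Nat.eq_zero_or_pos j with rfl | hj0
    · simp [S]
    · exact (h j hj0 (Finset.mem_range.mp hj).le).le
  linarith

theorem S_pos_of_pos {ι : Type*} [Fintype ι] {lam : ι → ℝ} (h : ∀ i, 0 < lam i) {k : ℕ}
    (hk : k ≤ Fintype.card ι) : 0 < S k lam :=
  Finset.sum_pos (fun _ _ => Finset.prod_pos fun i _ => h i)
    (Finset.powersetCard_nonempty.mpr hk)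

theorem S_one {ι : Type*} [Fintype ι] (lam : ι → ℝ) : S 1 lam = ∑ i, lam i := by
  simp [S, Finset.powersetCard_one]

/-- Each index lies in equally many `m`-element subsets. -/
theorem card_filter_mem_eq (n m : ℕ) (i j : Fin n) :
    #{s : MIdx n m | i ∈ s.1} = #{s : MIdx n m | j ∈ s.1} := by
  let e : MIdx n m ≃ MIdx n m :=
    (Equiv.swap i j).finsetCongr.subtypeEquiv fun s => by simp
  refine Finset.card_equiv e fun s => ?_
  simp [e, Equiv.finsetCongr]

/-- The sum of all `m`-fold sums is a nonnegative multiple of the total sum. -/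
theorem exists_sum_sumVec_eq_mul (n m : ℕ) (μ : Fin n → ℝ) :
    ∃ c : ℕ, ∑ s, sumVec n m μ s = c * ∑ i, μ i := by
  have hcount : ∑ s, sumVec n m μ s = ∑ i, (#{s : MIdx n m | i ∈ s.1} : ℝ) * μ i := by
    simp_rw [sumVec, ← nsmul_eq_mul, ← Finset.sum_const]
    exact Finset.sum_comm' (by simp)
  rcases isEmpty_or_nonempty (Fin n) with _ | ⟨⟨i₀⟩⟩
  · exact ⟨0, by simp [hcount]⟩
  · refine ⟨#{s : MIdx n m | i₀ ∈ s.1}, ?_⟩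
    rw [hcount, Finset.mul_sum]
    exact Finset.sum_congr rfl fun i _ => by rw [card_filter_mem_eq n m i i₀]

/-- `Γ_n ⊆ Γ_k^{(m)} ⊆ Γ_1`. -/
theorem stmt1 (n m k : ℕ) (hn : 2 ≤ n) (hm1 : 1 ≤ m) (hm : m ≤ n - 1)
    (hk1 : 1 ≤ k) (hk : k ≤ n.choose m) :
    Gamma (Fin n) n ⊆ GammaGen n m k ∧ GammaGen n m k ⊆ Gamma (Fin n) 1 := by
  refine ⟨fun μ hμ i _ hi => ?_, fun μ hμ i hi1 hi2 => ?_⟩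
  · have hpos : ∀ j, 0 < μ j := pos_of_mem_Gamma_card (by simpa using hμ)
    refine S_pos_of_pos (fun s => Finset.sum_pos (fun j _ => hpos j) ?_) ?_
    · exact Finset.card_pos.mp (by rw [s.2]; exact hm1)
    · simpa using hi.trans hk
  · obtain rfl : i = 1 := le_antisymm hi2 hi1
    have h1 : 0 < S 1 (sumVec n m μ) := hμ 1 le_rfl hk1
    obtain ⟨c, hc⟩ := exists_sum_sumVec_eq_mul n m μ
    rw [S_one, hc] at h1
    rw [S_one]
    exact pos_of_mul_pos_right h1 c.cast_nonneg
end
end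

section
/- Let λ = (λ_1, …, λ_n) ∈ Γ_k for some 1 ≤ k ≤ n, with λ_1 ≥ λ_2 ≥ ⋯ ≥ λ_n. Then S_{k−1}(λ|n) ≥ S_{k−1}(λ|n−1) ≥ ⋯ ≥ S_{k−1}(λ|1) > 0; that is, the quantities S_{k−1}(λ|i) are positive and nondecreasing in i. -/
open Finset

noncomputable section

open Polynomial in
theorem coeff_prod_one_add_C_mul_X {ι : Type*} (s : Finset ι) (f : ι → ℝ) (k : ℕ) :
    (∏ i ∈ s, (1 + C (f i) * X)).coeff k = ∑ t ∈ s.powersetCard k, ∏ i ∈ t, f i := by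
  rw [Finset.prod_one_add, finsetSum_coeff, Finset.powersetCard_eq_filter,
    Finset.sum_filter]
  refine Finset.sum_congr rfl fun t _ => ?_
  rw [Finset.prod_mul_distrib, Finset.prod_const, ← map_prod, coeff_C_mul_X_pow]
  simp only [eq_comm]

open Polynomial in
theorem S_eq_coeff {ι : Type*} [Fintype ι] (k : ℕ) (f : ι → ℝ) :
    S k f = (∏ i, (1 + C (f i) * X)).coeff k :=
  (coeff_prod_one_add_C_mul_X _ f k).symm

open Polynomial in
theorem S_update_zero_eq_coeff {ι : Type*} [Fintype ι] [DecidableEq ι] (k : ℕ) (f : ι → ℝ)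
    (i : ι) :
    S k (Function.update f i 0) = (∏ j ∈ univ.erase i, (1 + C (f j) * X)).coeff k := by
  rw [S_eq_coeff, ← Finset.mul_prod_erase univ _ (mem_univ i)]
  simp only [Function.update_self, map_zero, zero_mul, add_zero, one_mul]
  congr 1
  refine Finset.prod_congr rfl fun j hj => ?_
  rw [Function.update_of_ne (Finset.ne_of_mem_erase hj)]

namespace Polynomial

theorem Splits.derivative_real {p : ℝ[X]} (hp : p.Splits) : p.derivative.Splits := by
  rw [splits_iff_card_roots]
  have h1 := card_roots_le_derivative p
  have h2 := card_roots' p.derivative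
  have h3 := natDegree_derivative_le p
  rcases Nat.eq_zero_or_pos p.natDegree with h0 | h0
  · rw [natDegree_eq_zero.mp h0 |>.choose_spec.symm]
    simp
  · rw [← hp.natDegree_eq_card_roots] at h1
    omega

/-- The Newton inequality for the three lowest coefficients of a real-rooted polynomial. -/
theorem Splits.two_mul_coeff_zero_mul_coeff_two_le {p : ℝ[X]} (hp : p.Splits) :
    2 * (p.coeff 0 * p.coeff 2) ≤ p.coeff 1 ^ 2 := by
  induction hp using Submonoid.closure_induction_left with
  | one => simp [coeff_one]
  | mul_left x hx y hy ih =>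
    rcases hx with ⟨a, rfl⟩ | ⟨a, rfl⟩
    · simp only [coeff_C_mul]
      nlinarith [mul_le_mul_of_nonneg_left ih (sq_nonneg a)]
    · simp only [add_mul, coeff_add, coeff_C_mul, coeff_X_mul, coeff_X_mul_zero]
      nlinarith [mul_le_mul_of_nonneg_left ih (sq_nonneg a), sq_nonneg (y.coeff 0)]

/-- Newton's inequality, with a constant that does not depend on the degree. -/
theorem Splits.add_two_mul_coeff_mul_coeff_le {p : ℝ[X]} (hp : p.Splits) (m : ℕ) :
    (m + 2) * (p.coeff m * p.coeff (m + 2)) ≤ (m + 1) * p.coeff (m + 1) ^ 2 := by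
  induction m generalizing p with
  | zero => simpa using hp.two_mul_coeff_zero_mul_coeff_two_le
  | succ m ih =>
    have h := ih hp.derivative_real
    simp only [coeff_derivative] at h
    push_cast at h ⊢
    rw [show m + 1 + 2 = m + 2 + 1 from rfl]
    refine le_of_mul_le_mul_left (a := ((m : ℝ) + 1) * (m + 2)) ?_ (by positivity)
    linarith

theorem Splits.coeff_mul_coeff_le_sq {p : ℝ[X]} (hp : p.Splits) (m : ℕ) :
    p.coeff m * p.coeff (m + 2) ≤ p.coeff (m + 1) ^ 2 := by
  refine le_of_mul_le_mul_left (a := (m : ℝ) + 2) ?_ (by positivity)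
  linarith [hp.add_two_mul_coeff_mul_coeff_le m, sq_nonneg (p.coeff (m + 1))]

theorem coeff_pos_of_coeff_one_add_C_mul_X_mul_pos {q : ℝ[X]} (hq : q.Splits) (a : ℝ) {k : ℕ}
    (h : ∀ j ≤ k, 0 < ((1 + C a * X) * q).coeff j) : ∀ j < k, 0 < q.coeff j := by
  have hsucc : ∀ j, ((1 + C a * X) * q).coeff (j + 1) = q.coeff (j + 1) + a * q.coeff j := by
    intro j
    rw [add_mul, one_mul, mul_assoc, coeff_add, coeff_C_mul, coeff_X_mul]
  have hzero : 0 < q.coeff 0 := by simpa [add_mul, mul_assoc] using h 0 (Nat.zero_le k)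
  intro j
  induction j with
  | zero => exact fun _ => hzero
  | succ j ih =>
    intro hj
    have hqj := ih (by omega)
    have h1 := h (j + 1) (by omega)
    have h2 := h (j + 2) (by omega)
    rw [hsucc] at h1 h2
    by_contra! hneg
    have hmul : 0 < (q.coeff (j + 2) + a * q.coeff (j + 1)) * q.coeff j := mul_pos h2 hqj
    nlinarith [hq.coeff_mul_coeff_le_sq j, mul_nonneg_of_nonpos_of_nonpos hneg hneg,
      mul_nonneg h1.le (neg_nonneg.mpr hneg)]

theorem splits_prod_one_add_C_mul_X {ι : Type*} (s : Finset ι) (f : ι → ℝ) :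
    (∏ i ∈ s, (1 + C (f i) * X)).Splits := by
  refine Splits.prod fun i _ => Splits.of_natDegree_le_one ?_
  rw [add_comm, ← C_1]
  exact natDegree_linear_le

theorem coeff_prod_erase_pos {ι : Type*} [DecidableEq ι] {s : Finset ι} {i : ι} (hi : i ∈ s)
    (f : ι → ℝ) {k : ℕ} (h : ∀ j ≤ k, 0 < (∏ l ∈ s, (1 + C (f l) * X)).coeff j) :
    ∀ j < k, 0 < (∏ l ∈ s.erase i, (1 + C (f l) * X)).coeff j := by
  refine coeff_pos_of_coeff_one_add_C_mul_X_mul_pos (splits_prod_one_add_C_mul_X _ f) (f i) ?_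
  rwa [Finset.mul_prod_erase s (fun l => 1 + C (f l) * X) hi]

end Polynomial

/-- For `λ ∈ Γ_k` arranged in decreasing order, the quantities
`S_{k-1}(λ|i)` are positive and nondecreasing in `i`. -/
theorem stmt4 (n k : ℕ) (hk1 : 1 ≤ k) (hkn : k ≤ n) (lam : Fin n → ℝ)
    (hG : lam ∈ Gamma (Fin n) k) (hmono : ∀ i j : Fin n, i ≤ j → lam j ≤ lam i) :
    (∀ i : Fin n, 0 < S (k-1) (Function.update lam i 0)) ∧
    (∀ i j : Fin n, i ≤ j →
      S (k-1) (Function.update lam i 0) ≤ S (k-1) (Function.update lam j 0)) := by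
  obtain ⟨k, rfl⟩ := Nat.exists_eq_add_of_le' hk1
  have hpos : ∀ j ≤ k + 1,
      0 < (∏ i, (1 + Polynomial.C (lam i) * Polynomial.X)).coeff j := by
    intro j hj
    rw [← S_eq_coeff]
    rcases Nat.eq_zero_or_pos j with rfl | hj0
    · simp [S]
    · exact hG j hj0 hj
  have herase := fun i => Polynomial.coeff_prod_erase_pos (mem_univ i) lam hpos
  simp only [Nat.add_sub_cancel, S_update_zero_eq_coeff]
  refine ⟨fun i => herase i k (Nat.lt_succ_self k), fun i j hij => ?_⟩
  rcases eq_or_ne i j with rfl | hne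
  · exact le_rfl
  rcases k with _ | k
  · simp [coeff_prod_one_add_C_mul_X]
  have hji : j ∈ univ.erase i := mem_erase.mpr ⟨hne.symm, mem_univ j⟩
  have hij' : i ∈ univ.erase j := mem_erase.mpr ⟨hne, mem_univ i⟩
  have hq := Polynomial.coeff_prod_erase_pos hji lam
    (fun l hl => herase i l (Nat.lt_succ_of_le hl)) k (Nat.lt_succ_self k)
  rw [← Finset.mul_prod_erase _ _ hji, ← Finset.mul_prod_erase _ _ hij',
    Finset.erase_right_comm (a := j)]
  simp only [add_mul, one_mul, mul_assoc, Polynomial.coeff_add, Polynomial.coeff_C_mul,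
    Polynomial.coeff_X_mul]
  nlinarith [mul_le_mul_of_nonneg_right (hmono i j hij) hq.le]
end
end

section
/- Let 1 ≤ k ≤ n. If λ = (λ_1, …, λ_n) ∈ Γ_k with λ_1 ≥ λ_2 ≥ ⋯ ≥ λ_n, then λ_1 ≥ λ_2 ≥ ⋯ ≥ λ_k > 0, and there exists a positive constant C(n,k), depending only on n and k, such that S_{k−1}(λ|k) ≥ C(n,k) S_{k−1}(λ). -/
open Finset

noncomputable section

/-- The `m`-th elementary symmetric sum of the values of `x` on the finite set `s`. -/
def esum {ι : Type*} (x : ι → ℝ) (s : Finset ι) (m : ℕ) : ℝ :=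
  ∑ t ∈ s.powersetCard m, ∏ i ∈ t, x i

section Esum

variable {ι : Type*} (x : ι → ℝ)

lemma esum_zero (s : Finset ι) : esum x s 0 = 1 := by simp [esum]

lemma esum_one (s : Finset ι) : esum x s 1 = ∑ i ∈ s, x i := by
  simp [esum, Finset.powersetCard_one]

lemma esum_empty_succ (m : ℕ) : esum x ∅ (m + 1) = 0 := by
  unfold esum
  rw [Finset.powersetCard_eq_empty.2 (by simp), Finset.sum_empty]

variable [DecidableEq ι]

lemma esum_insert {s : Finset ι} {a : ι} (ha : a ∉ s) (m : ℕ) :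
    esum x (insert a s) (m + 1) = x a * esum x s m + esum x s (m + 1) := by
  unfold esum
  rw [Finset.powersetCard_succ_insert ha, Finset.sum_union, Finset.sum_image, add_comm,
    Finset.mul_sum]
  · congr 1
    refine Finset.sum_congr rfl fun t ht => ?_
    rw [Finset.prod_insert fun h => ha ((Finset.mem_powersetCard.1 ht).1 h)]
  · intro t ht u hu h
    have ht' : a ∉ t := fun h => ha ((Finset.mem_powersetCard.1 ht).1 h)
    have hu' : a ∉ u := fun h => ha ((Finset.mem_powersetCard.1 hu).1 h)
    rw [← Finset.erase_insert ht', h, Finset.erase_insert hu']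
  · rw [Finset.disjoint_left]
    intro t ht h
    obtain ⟨u, -, rfl⟩ := Finset.mem_image.1 h
    exact ha ((Finset.mem_powersetCard.1 ht).1 (Finset.mem_insert_self a u))

lemma esum_erase {s : Finset ι} {a : ι} (ha : a ∈ s) (m : ℕ) :
    esum x s (m + 1) = x a * esum x (s.erase a) m + esum x (s.erase a) (m + 1) := by
  rw [← esum_insert x (Finset.notMem_erase a s), Finset.insert_erase ha]

lemma sum_mul_esum_erase (s : Finset ι) (m : ℕ) :
    ∑ i ∈ s, x i * esum x (s.erase i) m = (m + 1) * esum x s (m + 1) := by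
  induction s using Finset.induction_on generalizing m with
  | empty => simp [esum_empty_succ]
  | insert a s ha ih =>
    rw [Finset.sum_insert ha, Finset.erase_insert ha, esum_insert x ha]
    have key : ∀ i ∈ s, (insert a s).erase i = insert a (s.erase i) := fun i hi =>
      Finset.erase_insert_of_ne fun h => ha (h ▸ hi)
    have hna : ∀ i, a ∉ s.erase i := fun i h => ha (Finset.mem_of_mem_erase h)
    rw [Finset.sum_congr rfl fun i hi => by rw [key i hi]]
    cases m with
    | zero =>
      have h0 := ih 0
      simp only [esum_zero] at h0 ⊢
      push_cast at h0 ⊢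
      linarith
    | succ m =>
      have h1 := ih m
      have h2 := ih (m + 1)
      rw [Finset.sum_congr rfl fun i _ => by
        rw [esum_insert x (hna i), mul_add, mul_left_comm], Finset.sum_add_distrib,
        ← Finset.mul_sum, h1, h2]
      push_cast
      ring

/-- A sum-of-squares recursion for the Newton defect `e_j² - e_{j-1} e_{j+1}`. -/
lemma newton_defect_recursion (s : Finset ι) (j : ℕ) :
    (j + 3) * (esum x s (j + 2) ^ 2 - esum x s (j + 1) * esum x s (j + 3)) =
      esum x s (j + 2) ^ 2 + ∑ i ∈ s, x i ^ 2 *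
        (esum x (s.erase i) (j + 1) ^ 2 - esum x (s.erase i) j * esum x (s.erase i) (j + 2)) := by
  have h : ∀ i ∈ s, x i ^ 2 *
        (esum x (s.erase i) (j + 1) ^ 2 - esum x (s.erase i) j * esum x (s.erase i) (j + 2)) =
      esum x s (j + 2) * (x i * esum x (s.erase i) (j + 1)) -
        esum x s (j + 1) * (x i * esum x (s.erase i) (j + 2)) := fun i hi => by
    rw [esum_erase x hi (j + 1), esum_erase x hi j]
    ring
  rw [Finset.sum_congr rfl h, Finset.sum_sub_distrib, ← Finset.mul_sum, ← Finset.mul_sum,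
    sum_mul_esum_erase, sum_mul_esum_erase]
  push_cast
  ring

lemma two_mul_newton_defect_one (s : Finset ι) :
    2 * (esum x s 1 ^ 2 - esum x s 0 * esum x s 2) = esum x s 1 ^ 2 + ∑ i ∈ s, x i ^ 2 := by
  have h : ∀ i ∈ s, x i ^ 2 = esum x s 1 * x i - x i * esum x (s.erase i) 1 := fun i hi => by
    rw [esum_erase x hi 0, esum_zero]
    ring
  rw [Finset.sum_congr rfl h, Finset.sum_sub_distrib, ← Finset.mul_sum, ← esum_one,
    sum_mul_esum_erase, esum_zero]
  push_cast
  ring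

lemma newton_defect_nonneg (s : Finset ι) (j : ℕ) :
    0 ≤ esum x s (j + 1) ^ 2 - esum x s j * esum x s (j + 2) := by
  induction j generalizing s with
  | zero =>
    have h := two_mul_newton_defect_one x s
    have : 0 ≤ ∑ i ∈ s, x i ^ 2 := Finset.sum_nonneg fun i _ => sq_nonneg _
    nlinarith [sq_nonneg (esum x s 1)]
  | succ j ih =>
    have h := newton_defect_recursion x s j
    refine nonneg_of_mul_nonneg_right (h ▸ ?_) (by positivity : (0 : ℝ) < j + 3)
    exact add_nonneg (sq_nonneg _)
      (Finset.sum_nonneg fun i _ => mul_nonneg (sq_nonneg _) (ih _))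

/-- Quantitative Newton inequality: the defect dominates the square of every monomial. -/
lemma sq_prod_le_newton_defect (s t : Finset ι) (j : ℕ) (hts : t ⊆ s) (ht : t.card = j + 1) :
    (∏ i ∈ t, x i) ^ 2 ≤
      (j + 2).factorial * (esum x s (j + 1) ^ 2 - esum x s j * esum x s (j + 2)) := by
  induction j generalizing s t with
  | zero =>
    obtain ⟨a, rfl⟩ := Finset.card_eq_one.1 ht
    have h := two_mul_newton_defect_one x s
    have := Finset.single_le_sum (f := fun i => x i ^ 2) (fun i _ => sq_nonneg (x i))
      (Finset.singleton_subset_iff.1 hts)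
    simp only [Finset.prod_singleton, zero_add, Nat.factorial_two, Nat.cast_ofNat] at *
    nlinarith [sq_nonneg (esum x s 1)]
  | succ j ih =>
    obtain ⟨a, ha⟩ : t.Nonempty := Finset.card_pos.1 (by omega)
    have h := newton_defect_recursion x s j
    have h1 := Finset.single_le_sum (f := fun i => x i ^ 2 *
        (esum x (s.erase i) (j + 1) ^ 2 - esum x (s.erase i) j * esum x (s.erase i) (j + 2)))
      (fun i _ => mul_nonneg (sq_nonneg _) (newton_defect_nonneg x _ j)) (hts ha)
    have h2 := ih (s.erase a) (t.erase a) (Finset.erase_subset_erase a hts)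
      (by rw [Finset.card_erase_of_mem ha]; omega)
    have h3 := mul_le_mul_of_nonneg_left h2 (sq_nonneg (x a))
    rw [← Finset.mul_prod_erase t x ha, mul_pow]
    have h4 : x a ^ 2 * (esum x (s.erase a) (j + 1) ^ 2 -
        esum x (s.erase a) j * esum x (s.erase a) (j + 2)) ≤
        (j + 3) * (esum x s (j + 2) ^ 2 - esum x s (j + 1) * esum x s (j + 3)) := by
      rw [h]
      linarith [sq_nonneg (esum x s (j + 2))]
    have h5 := mul_le_mul_of_nonneg_left h4 (Nat.cast_nonneg (α := ℝ) (j + 2).factorial)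
    have h6 : ((j + 1 + 2).factorial : ℝ) = (j + 3) * (j + 2).factorial := by
      rw [show j + 1 + 2 = (j + 2) + 1 by ring, Nat.factorial_succ]
      push_cast
      ring
    rw [h6]
    change _ ≤ _ * (esum x s (j + 2) ^ 2 - esum x s (j + 1) * esum x s (j + 3))
    linarith

/-- Deleting an entry maps the Gårding cone `Γ_{k+1}` into `Γ_k`. -/
lemma esum_erase_pos {s : Finset ι} {a : ι} (ha : a ∈ s) {k : ℕ}
    (h : ∀ m ≤ k + 1, 0 < esum x s m) : ∀ m ≤ k, 0 < esum x (s.erase a) m := by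
  induction k with
  | zero =>
    intro m hm
    obtain rfl : m = 0 := by omega
    simp [esum_zero]
  | succ k ih =>
    have ih' := ih fun m hm => h m (by omega)
    intro m hm
    rcases Nat.lt_or_ge m (k + 1) with hlt | hge
    · exact ih' m (by omega)
    obtain rfl : m = k + 1 := by omega
    by_contra! hneg
    have h0 := ih' k le_rfl
    have h1 := h (k + 1) (by omega)
    have h2 := h (k + 2) (by omega)
    rw [esum_erase x ha k] at h1
    rw [esum_erase x ha (k + 1)] at h2
    have hN := newton_defect_nonneg x (s.erase a) k
    nlinarith [mul_pos h0 h2, mul_nonneg (neg_nonneg.2 hneg) h1.le]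

lemma esum_sdiff_pos {s t : Finset ι} (hts : t ⊆ s) {k : ℕ}
    (h : ∀ m ≤ k + t.card, 0 < esum x s m) : ∀ m ≤ k, 0 < esum x (s \ t) m := by
  induction t using Finset.induction_on generalizing k with
  | empty => simpa using h
  | insert a t ha ih =>
    rw [Finset.card_insert_of_notMem ha] at h
    have h1 := ih (k := k + 1) ((Finset.subset_insert a t).trans hts)
      fun m hm => h m (by omega)
    rw [Finset.sdiff_insert]
    exact esum_erase_pos x
      (Finset.mem_sdiff.2 ⟨hts (Finset.mem_insert_self a t), ha⟩) h1

lemma esum_update_zero {s : Finset ι} {a : ι} (ha : a ∈ s) (m : ℕ) :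
    esum (Function.update x a 0) s m = esum x (s.erase a) m := by
  have h : ∀ m, esum (Function.update x a 0) (s.erase a) m = esum x (s.erase a) m := fun m =>
    Finset.sum_congr rfl fun t ht => Finset.prod_congr rfl fun i hi =>
      Function.update_of_ne
        (Finset.ne_of_mem_erase ((Finset.mem_powersetCard.1 ht).1 hi)) _ _
  cases m with
  | zero => simp [esum_zero]
  | succ m => rw [esum_erase _ ha, h, h]; simp

end Esum

section Ordered

variable {n : ℕ}

lemma val_le_of_strictMono {m : ℕ} {f : Fin m → Fin n} (hf : StrictMono f) (r : Fin m) :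
    (r : ℕ) ≤ f r := by
  obtain ⟨r, hr⟩ := r
  induction r with
  | zero => exact Nat.zero_le _
  | succ r ih =>
    have h1 := ih (by omega)
    have h2 : f ⟨r, by omega⟩ < f ⟨r + 1, hr⟩ := hf (by simp [Fin.lt_def])
    rw [Fin.lt_def] at h2
    exact Nat.succ_le_of_lt (h1.trans_lt h2)

variable {k : ℕ} {lam : Fin n → ℝ}

lemma esum_univ_pos_of_mem_Gamma (h : lam ∈ Gamma (Fin n) k) :
    ∀ m ≤ k, 0 < esum lam univ m := by
  intro m hm
  rcases Nat.eq_zero_or_pos m with rfl | hpos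
  · simp [esum_zero]
  · exact h m hpos hm

lemma sum_Ici_pos (h : lam ∈ Gamma (Fin n) k) {j : Fin n} (hj : (j : ℕ) < k) :
    0 < ∑ i ∈ Ici j, lam i := by
  have h1 := esum_sdiff_pos lam (Finset.subset_univ (Iio j)) (k := 1)
    (fun m hm => esum_univ_pos_of_mem_Gamma h m (by rw [Fin.card_Iio] at hm; omega)) 1 le_rfl
  rw [esum_one] at h1
  convert h1 using 2
  ext i
  simp

lemma pos_of_mem_Gamma (h : lam ∈ Gamma (Fin n) k)
    (hmono : ∀ i j : Fin n, i ≤ j → lam j ≤ lam i) {j : Fin n} (hj : (j : ℕ) < k) :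
    0 < lam j := by
  by_contra! hneg
  refine (sum_Ici_pos h hj).not_ge (Finset.sum_nonpos fun i hi => ?_)
  exact (hmono j i (Finset.mem_Ici.1 hi)).trans hneg

lemma abs_le_of_mem_Gamma (h : lam ∈ Gamma (Fin n) k)
    (hmono : ∀ i j : Fin n, i ≤ j → lam j ≤ lam i) {i j : Fin n} (hj : (j : ℕ) < k)
    (hij : j ≤ i) : |lam i| ≤ n * lam j := by
  have hpos := pos_of_mem_Gamma h hmono hj
  have hn : (1 : ℝ) ≤ n := by exact_mod_cast j.pos
  rw [abs_le]
  refine ⟨?_, (hmono j i hij).trans (by nlinarith)⟩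
  have h1 := sum_Ici_pos h hj
  rw [← Finset.add_sum_erase _ _ (Finset.mem_Ici.2 hij)] at h1
  have h2 : ∑ l ∈ (Ici j).erase i, lam l ≤ ((Ici j).erase i).card • lam j :=
    Finset.sum_le_card_nsmul _ _ _ fun l hl =>
      hmono j l (Finset.mem_Ici.1 (Finset.mem_of_mem_erase hl))
  have h3 : (((Ici j).erase i).card : ℝ) ≤ n := by
    exact_mod_cast (Finset.card_le_univ _).trans_eq (Fintype.card_fin n)
  rw [nsmul_eq_mul] at h2
  nlinarith [mul_le_mul_of_nonneg_right h3 hpos.le]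

lemma abs_prod_le_of_mem_Gamma (h : lam ∈ Gamma (Fin n) k)
    (hmono : ∀ i j : Fin n, i ≤ j → lam j ≤ lam i) {m : ℕ} (hmk : m ≤ k) (hmn : m ≤ n)
    {t : Finset (Fin n)} (ht : t.card = m) :
    |∏ i ∈ t, lam i| ≤ n ^ m * ∏ r : Fin m, lam (Fin.castLE hmn r) := by
  have h1 : ∏ i ∈ t, lam i = ∏ r : Fin m, lam (t.orderEmbOfFin ht r) := by
    conv_lhs => rw [← Finset.map_orderEmbOfFin_univ t ht]
    rw [Finset.prod_map]
    rfl
  have h2 : (n : ℝ) ^ m * ∏ r : Fin m, lam (Fin.castLE hmn r) =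
      ∏ r : Fin m, (n * lam (Fin.castLE hmn r)) := by
    simp [Finset.prod_mul_distrib]
  rw [h1, h2, Finset.abs_prod]
  refine Finset.prod_le_prod (fun _ _ => abs_nonneg _) fun r _ =>
    abs_le_of_mem_Gamma h hmono (by simp; omega) ?_
  rw [Fin.le_def]
  exact val_le_of_strictMono (t.orderEmbOfFin ht).strictMono r

lemma esum_univ_le_of_mem_Gamma (h : lam ∈ Gamma (Fin n) k)
    (hmono : ∀ i j : Fin n, i ≤ j → lam j ≤ lam i) {m : ℕ} (hmk : m ≤ k) (hmn : m ≤ n) :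
    esum lam univ m ≤ n.choose m * n ^ m * ∏ r : Fin m, lam (Fin.castLE hmn r) := by
  refine (Finset.sum_le_card_nsmul _ _ _ fun t ht => (le_abs_self _).trans
    (abs_prod_le_of_mem_Gamma h hmono hmk hmn (Finset.mem_powersetCard.1 ht).2)).trans_eq ?_
  rw [Finset.card_powersetCard, Finset.card_univ, Fintype.card_fin, nsmul_eq_mul, mul_assoc]

end Ordered

/-- For `λ ∈ Γ_k` decreasing, the first `k` entries are positive and
`S_{k-1}(λ|k) ≥ C(n,k) S_{k-1}(λ)` for a constant depending only on `n` and `k`. -/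
theorem stmt5 (n k : ℕ) (hk1 : 1 ≤ k) (hkn : k ≤ n) :
    ∃ C : ℝ, 0 < C ∧ ∀ lam : Fin n → ℝ, lam ∈ Gamma (Fin n) k →
      (∀ i j : Fin n, i ≤ j → lam j ≤ lam i) →
      (∀ i : Fin n, (i : ℕ) < k → 0 < lam i) ∧
      C * S (k-1) lam ≤ S (k-1) (Function.update lam ⟨k-1, by omega⟩ 0) := by
  rcases Nat.lt_or_ge 1 k with hk | hk
  swap
  · obtain rfl : k = 1 := by omega
    refine ⟨1, one_pos, fun lam h hmono => ⟨fun i hi => pos_of_mem_Gamma h hmono hi, ?_⟩⟩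
    simp [S]
  obtain ⟨j, rfl⟩ : ∃ j, k = j + 2 := ⟨k - 2, by omega⟩
  have hmn : j + 1 ≤ n := by omega
  set B : ℝ := n.choose (j + 1) * n ^ (j + 1)
  have hBpos : 0 < B := by
    have h1 : 0 < n.choose (j + 1) := Nat.choose_pos hmn
    have h2 : 0 < n := by omega
    positivity
  have hFpos : (0 : ℝ) < (j + 2).factorial := by positivity
  refine ⟨1 / (B ^ 2 * (j + 2).factorial), by positivity, fun lam h hmono =>
    ⟨fun i hi => pos_of_mem_Gamma h hmono hi, ?_⟩⟩
  set a : Fin n := ⟨j + 2 - 1, by omega⟩ with ha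
  change _ * esum lam univ (j + 1) ≤ esum (Function.update lam a 0) univ (j + 1)
  rw [esum_update_zero lam (Finset.mem_univ a), div_mul_eq_mul_div, one_mul,
    div_le_iff₀ (by positivity)]
  have hpos := esum_univ_pos_of_mem_Gamma h
  have hpos' := esum_erase_pos lam (Finset.mem_univ a) hpos
  have hT := hpos (j + 1) (by omega)
  have hle := esum_univ_le_of_mem_Gamma h hmono (m := j + 1) (by omega) hmn
  have hsub : univ.map (Fin.castLEEmb hmn) ⊆ univ.erase a := by
    intro i hi
    obtain ⟨r, -, rfl⟩ := Finset.mem_map.1 hi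
    refine Finset.mem_erase.2 ⟨fun h => ?_, Finset.mem_univ _⟩
    have := congrArg Fin.val h
    simp [ha] at this
    omega
  have hN := sq_prod_le_newton_defect lam _ _ j hsub (by simp)
  rw [Finset.prod_map] at hN
  change (∏ r : Fin (j + 1), lam (Fin.castLE hmn r)) ^ 2 ≤ _ at hN
  have h1 := esum_erase lam (Finset.mem_univ a) j
  have h2 := esum_erase lam (Finset.mem_univ a) (j + 1)
  have hS := hpos (j + 2) le_rfl
  have hs0 := hpos' j (by omega)
  have hdefect : esum lam (univ.erase a) (j + 1) ^ 2 -
      esum lam (univ.erase a) j * esum lam (univ.erase a) (j + 2) ≤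
      esum lam (univ.erase a) (j + 1) * esum lam univ (j + 1) := by
    rw [h1]
    rw [h2] at hS
    nlinarith [mul_pos hs0 hS]
  have hsq := pow_le_pow_left₀ hT.le hle 2
  rw [mul_pow] at hsq
  refine le_of_mul_le_mul_right ?_ hT
  calc esum lam univ (j + 1) * esum lam univ (j + 1)
      ≤ B ^ 2 * (∏ r : Fin (j + 1), lam (Fin.castLE hmn r)) ^ 2 := by rw [← sq]; exact hsq
    _ ≤ B ^ 2 * ((j + 2).factorial *
          (esum lam (univ.erase a) (j + 1) * esum lam univ (j + 1))) := by
        gcongr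
        exact hN.trans (by gcongr)
    _ = _ := by ring
end
end

section
/- Let 1 ≤ k ≤ n. If λ = (λ_1, …, λ_n) ∈ Γ_k with λ_1 ≥ λ_2 ≥ ⋯ ≥ λ_n, then λ_1 S_{k−1}(λ|1) ≥ (k/n) S_k(λ). -/
open Finset

noncomputable section

section Newton

open Polynomial

/-- The generating polynomial `∏ (1 + λ_i X)` of the elementary symmetric functions. -/
def genPoly {ι : Type*} [Fintype ι] (lam : ι → ℝ) : ℝ[X] :=
  ∏ i, (1 + C (lam i) * X)

lemma coeff_genPoly {ι : Type*} [Fintype ι] (lam : ι → ℝ) (k : ℕ) :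
    (genPoly lam).coeff k = S k lam := by
  classical
  rw [genPoly, Finset.prod_one_add, finsetSum_coeff, S,
    Finset.powersetCard_eq_filter, Finset.sum_filter]
  refine Finset.sum_congr rfl fun s _ => ?_
  rw [Finset.prod_mul_distrib, Finset.prod_const, ← map_prod, coeff_C_mul_X_pow]
  simp only [eq_comm]

lemma splits_genPoly {ι : Type*} [Fintype ι] (lam : ι → ℝ) : (genPoly lam).Splits := by
  refine Splits.prod fun i _ => Splits.of_natDegree_le_one ?_
  compute_degree

lemma splits_derivative_real {p : ℝ[X]} (hp : p.Splits) : (derivative p).Splits := by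
  rw [splits_iff_card_roots] at hp ⊢
  have h1 := card_roots_le_derivative p
  have h2 := natDegree_derivative_le p
  have h3 := card_roots' (derivative p)
  omega

/-- The Laguerre inequality for real-rooted polynomials. -/
lemma laguerre_inequality {p : ℝ[X]} (hp : p.Splits) (x : ℝ) :
    p.eval x * (derivative (derivative p)).eval x ≤ (derivative p).eval x ^ 2 := by
  rw [hp.eq_prod_roots]
  generalize p.roots = s
  induction s using Multiset.induction_on with
  | empty => simp
  | cons a s ih =>
    rw [Multiset.map_cons, Multiset.prod_cons, mul_left_comm]
    set q := C p.leadingCoeff * (s.map fun a => X - C a).prod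
    simp only [derivative_mul, derivative_sub, derivative_X, derivative_C, eval_mul, eval_add,
      eval_sub, eval_X, eval_C, sub_zero, one_mul, derivative_add]
    nlinarith [sq_nonneg (q.eval x), mul_nonneg (sq_nonneg (x - a)) (sub_nonneg.2 ih)]

lemma splits_iterate_derivative_real {p : ℝ[X]} (hp : p.Splits) (k : ℕ) :
    (derivative^[k] p).Splits := by
  induction k with
  | zero => exact hp
  | succ k ih =>
    rw [Function.iterate_succ_apply']
    exact splits_derivative_real ih

/-- A weak form of Newton's inequality for the coefficients of a real-rooted polynomial. -/
lemma coeff_mul_coeff_le_sq {p : ℝ[X]} (hp : p.Splits) (k : ℕ) :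
    p.coeff k * p.coeff (k + 2) ≤ p.coeff (k + 1) ^ 2 := by
  have h := laguerre_inequality (splits_iterate_derivative_real hp k) 0
  simp only [← Function.iterate_succ_apply' derivative, ← coeff_zero_eq_eval_zero,
    coeff_iterate_derivative, zero_add, Nat.descFactorial_self, nsmul_eq_mul,
    Nat.factorial_succ] at h
  push_cast at h
  have hf : (0 : ℝ) < (k.factorial : ℝ) ^ 2 * (k + 1) := by positivity
  have h' : (k + 2 : ℝ) * (p.coeff k * p.coeff (k + 2)) ≤ (k + 1) * p.coeff (k + 1) ^ 2 := by
    refine le_of_mul_le_mul_left ?_ hf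
    linarith
  by_contra! hlt
  nlinarith [sq_nonneg (p.coeff (k + 1)), (Nat.cast_nonneg k : (0 : ℝ) ≤ k)]

end Newton

section Elementary

open Polynomial

variable {ι : Type*} [Fintype ι]

lemma S_zero (lam : ι → ℝ) : S 0 lam = 1 := by
  simp [S]

lemma S_mul_S_le_sq (lam : ι → ℝ) (k : ℕ) : S k lam * S (k + 2) lam ≤ S (k + 1) lam ^ 2 := by
  simpa only [coeff_genPoly] using coeff_mul_coeff_le_sq (splits_genPoly lam) k

variable [DecidableEq ι]

lemma genPoly_update_zero (lam : ι → ℝ) (i : ι) :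
    genPoly (Function.update lam i 0) = ∏ j ∈ univ.erase i, (1 + C (lam j) * X) := by
  rw [genPoly, ← Finset.mul_prod_erase _ _ (mem_univ i)]
  simp only [Function.update_self, C_0, zero_mul, add_zero, one_mul]
  exact Finset.prod_congr rfl fun j hj => by
    rw [Function.update_of_ne (Finset.ne_of_mem_erase hj)]

lemma S_succ_eq (lam : ι → ℝ) (i : ι) (k : ℕ) :
    S (k + 1) lam = S (k + 1) (Function.update lam i 0) +
      lam i * S k (Function.update lam i 0) := by
  have h : genPoly lam = genPoly (Function.update lam i 0) +
      C (lam i) * (X * genPoly (Function.update lam i 0)) := by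
    rw [genPoly_update_zero, genPoly, ← Finset.mul_prod_erase _ _ (mem_univ i)]
    ring
  simpa only [coeff_add, coeff_C_mul, coeff_X_mul, coeff_genPoly] using
    congrArg (fun p => coeff p (k + 1)) h

lemma sum_mul_S_update (lam : ι → ℝ) (k : ℕ) :
    ∑ i, lam i * S k (Function.update lam i 0) = ((k + 1 : ℕ) : ℝ) * S (k + 1) lam := by
  have h : derivative (genPoly lam) = ∑ i, C (lam i) * genPoly (Function.update lam i 0) := by
    rw [genPoly, derivative_prod_finset]
    exact Finset.sum_congr rfl fun i _ => by
      rw [genPoly_update_zero]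
      rw [derivative_add, derivative_one, zero_add, derivative_C_mul, derivative_X, mul_one,
        mul_comm]
  have h' := congrArg (fun p => coeff p k) h
  simp only [coeff_derivative, finsetSum_coeff, coeff_C_mul, coeff_genPoly] at h'
  rw [← h']
  push_cast
  ring

lemma sum_S_update (lam : ι → ℝ) (k : ℕ) :
    ∑ i, S k (Function.update lam i 0) = ((Fintype.card ι : ℝ) - k) * S k lam := by
  cases k with
  | zero => simp [S_zero]
  | succ k =>
    have h : ∀ i, S (k + 1) (Function.update lam i 0) =
        S (k + 1) lam - lam i * S k (Function.update lam i 0) := fun i => by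
      rw [S_succ_eq lam i]
      ring
    simp only [h, Finset.sum_sub_distrib, sum_mul_S_update, Finset.sum_const, Finset.card_univ,
      nsmul_eq_mul]
    ring

lemma update_zero_mem_Gamma {lam : ι → ℝ} {k : ℕ} (h : lam ∈ Gamma ι (k + 1)) (i : ι) :
    Function.update lam i 0 ∈ Gamma ι k := by
  suffices H : ∀ j ≤ k, 0 < S j (Function.update lam i 0) from fun j _ hj => H j hj
  intro j
  induction j with
  | zero => simp [S_zero]
  | succ j ih =>
    intro hj
    have hpos := ih (by omega)
    have h1 := h (j + 1) (by omega) (by omega)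
    have h2 := h (j + 2) (by omega) (by omega)
    have hN := S_mul_S_le_sq (Function.update lam i 0) j
    rw [S_succ_eq lam i] at h1 h2
    by_contra! hneg
    nlinarith [mul_pos hpos h2, mul_nonneg h1.le (neg_nonneg.2 hneg)]

end Elementary

/-- For `λ ∈ Γ_k` decreasing, `λ_1 S_{k-1}(λ|1) ≥ (k/n) S_k(λ)`. -/
theorem stmt6 (n k : ℕ) (hk1 : 1 ≤ k) (hkn : k ≤ n) (lam : Fin n → ℝ)
    (hG : lam ∈ Gamma (Fin n) k) (hmono : ∀ i j : Fin n, i ≤ j → lam j ≤ lam i) :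
    ((k : ℝ)/n) * S k lam ≤
      lam ⟨0, by omega⟩ * S (k-1) (Function.update lam ⟨0, by omega⟩ 0) := by
  obtain ⟨m, rfl⟩ : ∃ m, k = m + 1 := ⟨k - 1, by omega⟩
  have hn : (0 : ℝ) < n := by exact_mod_cast (by omega : 0 < n)
  rw [Nat.add_sub_cancel, div_mul_eq_mul_div, div_le_iff₀ hn]
  generalize hz : (⟨0, by omega⟩ : Fin n) = z
  have hmax : ∀ i, lam i ≤ lam z := fun i =>
    hmono z i (by rw [← hz]; exact Fin.mk_le_of_le_val (Nat.zero_le _))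
  have hrec := S_succ_eq lam z m
  have hS := hG (m + 1) hk1 le_rfl
  have hkn' : ((m + 1 : ℕ) : ℝ) ≤ n := by exact_mod_cast hkn
  set mu := Function.update lam z 0 with hmu
  rcases le_or_gt (S (m + 1) mu) 0 with h | h
  · nlinarith
  have hG' : mu ∈ Gamma (Fin n) (m + 1) := by
    intro i hi him
    rcases him.lt_or_eq with hlt | rfl
    · exact update_zero_mem_Gamma hG z i hi (by omega)
    · exact h
  have hnonneg : ∀ i, 0 ≤ S m (Function.update mu i 0) := by
    intro i
    rcases Nat.eq_zero_or_pos m with rfl | hm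
    · simp [S_zero]
    · exact (update_zero_mem_Gamma hG' i m hm le_rfl).le
  have hself : Function.update mu z 0 = mu := by simp [hmu]
  have hle : ∑ i, mu i * S m (Function.update mu i 0) ≤
      lam z * (∑ i, S m (Function.update mu i 0) - S m mu) := by
    rw [← Finset.add_sum_erase _ _ (mem_univ z),
      ← Finset.add_sum_erase _ (fun i => S m (Function.update mu i 0)) (mem_univ z),
      hself, add_sub_cancel_left, Finset.mul_sum, show mu z = 0 by simp [hmu], zero_mul, zero_add]
    refine Finset.sum_le_sum fun i hi => ?_
    rw [show mu i = lam i by simp [hmu, Finset.ne_of_mem_erase hi]]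
    exact mul_le_mul_of_nonneg_right (hmax i) (hnonneg i)
  rw [sum_mul_S_update, sum_S_update, Fintype.card_fin] at hle
  push_cast at hle ⊢
  rw [hrec]
  linarith
end
end

section
/- Let λ = (λ_1, …, λ_n) ∈ Γ_k ⊆ ℝ^n with 1 ≤ k ≤ n, and suppose λ_1 < 0 is the smallest entry of λ (λ_1 ≤ λ_i for all i). Then S_{k−1}(λ|1) ≥ (1/(n−k+1)) Σ_{i=1}^n S_{k−1}(λ|i); that is, ∂S_k/∂λ_1 ≥ (1/(n−k+1)) Σ_{i=1}^n ∂S_k/∂λ_i. -/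
open Finset

noncomputable section

/-- Setting the `i`-th entry to zero removes the terms of `S_k` that involve it. -/
theorem S_update_zero {ι : Type*} [Fintype ι] [DecidableEq ι] (k : ℕ) (lam : ι → ℝ) (i : ι) :
    S k (Function.update lam i 0) =
      ∑ s ∈ Finset.univ.powersetCard k, if i ∉ s then ∏ j ∈ s, lam j else 0 := by
  unfold S
  refine Finset.sum_congr rfl fun s _ => ?_
  split_ifs with h
  · exact Finset.prod_eq_zero h (by simp)
  · refine Finset.prod_congr rfl fun j hj => ?_
    rw [Function.update_of_ne (ne_of_mem_of_not_mem hj h)]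

theorem S_update_zero_eq_sum_erase {ι : Type*} [Fintype ι] [DecidableEq ι] (k : ℕ) (lam : ι → ℝ)
    (i : ι) :
    S k (Function.update lam i 0) =
      ∑ s ∈ (Finset.univ.erase i).powersetCard k, ∏ j ∈ s, lam j := by
  rw [S_update_zero, ← Finset.sum_filter]
  refine Finset.sum_congr ?_ fun _ _ => rfl
  ext s
  simp only [Finset.mem_filter, Finset.mem_powersetCard, Finset.subset_erase]
  tauto

/-- Expansion of `S_{k+1}` with respect to the `i`-th entry. -/
theorem S_succ_eq_add {ι : Type*} [Fintype ι] [DecidableEq ι] (k : ℕ) (lam : ι → ℝ) (i : ι) :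
    S (k + 1) lam =
      S (k + 1) (Function.update lam i 0) + lam i * S k (Function.update lam i 0) := by
  have hi : i ∉ Finset.univ.erase i := Finset.notMem_erase i _
  rw [S_update_zero_eq_sum_erase, S_update_zero_eq_sum_erase, S,
    ← Finset.insert_erase (Finset.mem_univ i), Finset.powersetCard_succ_insert hi,
    Finset.erase_insert hi, Finset.sum_union, Finset.sum_image, Finset.mul_sum]
  · congr 1
    refine Finset.sum_congr rfl fun s hs => Finset.prod_insert fun his => ?_
    exact hi ((Finset.mem_powersetCard.1 hs).1 his)
  · intro s hs t ht hst
    have hs' : i ∉ s := fun h => hi ((Finset.mem_powersetCard.1 hs).1 h)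
    have ht' : i ∉ t := fun h => hi ((Finset.mem_powersetCard.1 ht).1 h)
    rw [← Finset.erase_insert hs', hst, Finset.erase_insert ht']
  · rw [Finset.disjoint_left]
    intro s hs hs'
    obtain ⟨t, -, rfl⟩ := Finset.mem_image.1 hs'
    exact hi ((Finset.mem_powersetCard.1 hs).1 (Finset.mem_insert_self i t))

theorem sum_S_update_zero {ι : Type*} [Fintype ι] [DecidableEq ι] (k : ℕ) (lam : ι → ℝ) :
    ∑ i, S k (Function.update lam i 0) = ((Fintype.card ι : ℝ) - k) * S k lam := by
  simp_rw [S_update_zero]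
  rw [Finset.sum_comm, S, Finset.mul_sum]
  refine Finset.sum_congr rfl fun s hs => ?_
  rw [← Finset.sum_filter, Finset.sum_const, nsmul_eq_mul, Finset.filter_not,
    Finset.filter_mem_eq_inter, Finset.univ_inter, ← Finset.compl_eq_univ_sdiff,
    Finset.card_compl, Nat.cast_sub (Finset.card_le_univ s), (Finset.mem_powersetCard.1 hs).2]

/-- Deleting a negative entry from a vector in `Γ_k` keeps `S_0, …, S_k` positive. -/
theorem S_update_zero_pos {ι : Type*} [Fintype ι] [DecidableEq ι] {k : ℕ} {lam : ι → ℝ}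
    (hG : lam ∈ Gamma ι k) {i : ι} (hi : lam i < 0) {m : ℕ} (hm : m ≤ k) :
    0 < S m (Function.update lam i 0) := by
  induction m with
  | zero => simp [S]
  | succ m ih =>
    have hpos := hG (m + 1) (by omega) hm
    rw [S_succ_eq_add m lam i] at hpos
    linarith [mul_neg_of_neg_of_pos hi (ih (by omega))]

/-- If `λ ∈ Γ_k` and `λ_1 < 0` is the smallest entry, then
`S_{k-1}(λ|1) ≥ (1/(n-k+1)) Σ_i S_{k-1}(λ|i)`. -/
theorem stmt10 (n k : ℕ) (hk1 : 1 ≤ k) (hkn : k ≤ n)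
    (lam : Fin n → ℝ) (hG : lam ∈ Gamma (Fin n) k)
    (hneg : lam ⟨0, by omega⟩ < 0) (hmin : ∀ i : Fin n, lam ⟨0, by omega⟩ ≤ lam i) :
    (1/((n:ℝ) - k + 1)) * ∑ i : Fin n, S (k-1) (Function.update lam i 0) ≤
      S (k-1) (Function.update lam ⟨0, by omega⟩ 0) := by
  obtain ⟨j, rfl⟩ : ∃ j, k = j + 1 := ⟨k - 1, by omega⟩
  have hn : (0 : ℝ) < (n : ℝ) - j := by
    have : ((j + 1 : ℕ) : ℝ) ≤ n := by exact_mod_cast hkn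
    push_cast at this
    linarith
  have hc : (n : ℝ) - (j + 1 : ℕ) + 1 = n - j := by push_cast; ring
  rw [hc, Nat.add_sub_cancel, sum_S_update_zero, Fintype.card_fin, one_div,
    inv_mul_cancel_left₀ hn.ne']
  cases j with
  | zero => simp [S]
  | succ m =>
    rw [S_succ_eq_add m lam ⟨0, by omega⟩]
    linarith [mul_neg_of_neg_of_pos hneg (S_update_zero_pos hG hneg (m := m) (by omega))]
end
end
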